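/- In the normal means model, for every constant c3 ∈ (0,1) the following holds: for any estimator β̂ and any n, s with 2 ≤ s ≤ n, writing m = (n − s + 1)/2 and δ_n = (1/2)·√((n^{c3} − 1)/m), one has sup_{β ∈ B(n,s)} E_β‖β̂ − β‖² ≥ (c3/2)·(1 − sup_{β ∈ B(n,s)} P_β(FP(β̂) > 0) − δ_n)·s·log n. In particular, for some constant M > 0 and a sequence δ_n → 0 (as n, s → ∞ with limsup s/n ≤ ζ < 1), any estimator whose worst-case probability of making a false discovery tends to 0 must have sup_{β ∈ B(n,s)} E_β‖β̂ − β‖² ≥ M·(1 − o(1))·s·log n. -/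

import Mathlib

open MeasureTheory ProbabilityTheory Filter
open scoped ENNReal

/-- Normal means model: `y = β + ε` with `ε ~ N(0, I_n)`, i.e. the law of `y`
is the product of the Gaussians `N(β i, 1)`. -/
noncomputable def stdNormalMeans (n : ℕ) (β : Fin n → ℝ) : Measure (Fin n → ℝ) :=
  Measure.pi fun i => gaussianReal (β i) 1

/-- `B(n,s)`: vectors in `ℝ^n` with at most `s` nonzero coordinates. -/
def Sparse (n s : ℕ) : Set (Fin n → ℝ) := {β | {i | β i ≠ 0}.ncard ≤ s}

/-- Number of false positives of the estimate `b` when the truth is `β`. -/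
noncomputable def FPcount {n : ℕ} (b β : Fin n → ℝ) : ℕ :=
  {i | b i ≠ 0 ∧ β i = 0}.ncard

/-- Number of true positives of the estimate `b` when the truth is `β`. -/
noncomputable def TPcount {n : ℕ} (b β : Fin n → ℝ) : ℕ :=
  {i | b i ≠ 0 ∧ β i ≠ 0}.ncard

/-- Expected number of false positives `E_β[FP(β̂)]`. -/
noncomputable def expFP (n : ℕ) (bh : (Fin n → ℝ) → Fin n → ℝ) (β : Fin n → ℝ) : ℝ≥0∞ :=
  ∫⁻ y, (FPcount (bh y) β : ℝ≥0∞) ∂(stdNormalMeans n β)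

/-- `L²` risk `E_β ‖β̂ − β‖²`. -/
noncomputable def l2risk (n : ℕ) (bh : (Fin n → ℝ) → Fin n → ℝ) (β : Fin n → ℝ) : ℝ≥0∞ :=
  ∫⁻ y, ENNReal.ofReal (∑ i, (bh y i - β i) ^ 2) ∂(stdNormalMeans n β)

/-- Membership in `Ω_o(c1)`: a measurable estimator whose worst-case risk over
`B(n,s)` is at most `c1 · s · log(n/s)`. -/
def RateMinimax (n s : ℕ) (c1 : ℝ) (bh : (Fin n → ℝ) → Fin n → ℝ) : Prop :=
  Measurable bh ∧
    ∀ β ∈ Sparse n s, l2risk n bh β ≤ ENNReal.ofReal (c1 * s * Real.log ((n : ℝ) / s))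

/-- Likelihood ratio of `N(τ, 1)` against `N(0, 1)`. -/
noncomputable def gaussianLR (τ x : ℝ) : ℝ := Real.exp (τ * x - τ ^ 2 / 2)

lemma measurable_gaussianLR (τ : ℝ) : Measurable (gaussianLR τ) := by
  unfold gaussianLR; fun_prop

lemma gaussianReal_eq_withDensity_gaussianLR (τ : ℝ) :
    gaussianReal τ 1 =
      (gaussianReal 0 1).withDensity fun x => ENNReal.ofReal (gaussianLR τ x) := by
  rw [gaussianReal_of_var_ne_zero _ one_ne_zero, gaussianReal_of_var_ne_zero _ one_ne_zero,
    ← withDensity_mul _ (by fun_prop) (measurable_gaussianLR τ).ennreal_ofReal]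
  congr 1
  ext x
  rw [Pi.mul_apply, gaussianPDF, gaussianPDF, ← ENNReal.ofReal_mul (gaussianPDFReal_nonneg _ _ _),
    gaussianPDFReal, gaussianPDFReal, gaussianLR, mul_assoc _ (Real.exp _), ← Real.exp_add]
  congr 3
  simp only [NNReal.coe_one]
  ring

lemma integrable_gaussianLR (τ : ℝ) : Integrable (gaussianLR τ) (gaussianReal 0 1) := by
  have h : gaussianLR τ = fun x => Real.exp (τ * x) * Real.exp (-(τ ^ 2 / 2)) := by
    ext x; rw [gaussianLR, ← Real.exp_add]; ring_nf
  rw [h]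
  exact (integrable_exp_mul_gaussianReal τ).mul_const _

lemma integral_gaussianLR (τ : ℝ) : ∫ x, gaussianLR τ x ∂(gaussianReal 0 1) = 1 := by
  have h : gaussianLR τ = fun x => Real.exp (τ * x) * Real.exp (-(τ ^ 2 / 2)) := by
    ext x; rw [gaussianLR, ← Real.exp_add]; ring_nf
  have hm := congrFun (mgf_id_gaussianReal (μ := 0) (v := 1)) τ
  simp only [mgf, id] at hm
  rw [h, integral_mul_const, hm, ← Real.exp_add]
  simp

lemma gaussianLR_sq (τ x : ℝ) :
    gaussianLR τ x ^ 2 = gaussianLR (2 * τ) x * Real.exp (τ ^ 2) := by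
  rw [gaussianLR, gaussianLR, sq, ← Real.exp_add, ← Real.exp_add]
  ring_nf

lemma memLp_gaussianLR (τ : ℝ) : MemLp (gaussianLR τ) 2 (gaussianReal 0 1) := by
  rw [memLp_two_iff_integrable_sq (measurable_gaussianLR τ).aestronglyMeasurable]
  simp_rw [gaussianLR_sq]
  exact (integrable_gaussianLR _).mul_const _

lemma variance_gaussianLR (τ : ℝ) :
    variance (gaussianLR τ) (gaussianReal 0 1) = Real.exp (τ ^ 2) - 1 := by
  rw [variance_eq_sub (memLp_gaussianLR τ), integral_gaussianLR]
  simp only [Pi.pow_apply, gaussianLR_sq]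
  rw [integral_mul_const, integral_gaussianLR]
  ring

/-- Changing the measure of one coordinate of a product measure by a density. -/
lemma pi_update_withDensity {ι : Type*} [Fintype ι] [DecidableEq ι] (μ : ι → Measure ℝ)
    [∀ i, IsProbabilityMeasure (μ i)] (j : ι) {f : ℝ → ℝ≥0∞} (hf : Measurable f)
    (ν : Measure ℝ) [IsProbabilityMeasure ν] (hν : ν = (μ j).withDensity f) :
    Measure.pi (Function.update μ j ν) = (Measure.pi μ).withDensity fun y => f (y j) := by
  have hprob : ∀ i, IsProbabilityMeasure (Function.update μ j ν i) := by
    intro i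
    by_cases h : i = j
    · subst h; simpa
    · rw [Function.update_of_ne h]; infer_instance
  refine Measure.pi_eq fun t ht => ?_
  set g : ι → ℝ → ℝ≥0∞ := fun i => (t i).indicator (if i = j then f else 1) with hg
  have hgm : ∀ i, Measurable (g i) := by
    intro i
    refine Measurable.indicator ?_ (ht i)
    split_ifs
    · exact hf
    · exact measurable_one
  rw [withDensity_apply _ (MeasurableSet.univ_pi ht),
    ← lintegral_indicator (MeasurableSet.univ_pi ht)]
  have hprod : ∀ y : ι → ℝ, (Set.univ.pi t).indicator (fun y => f (y j)) y = ∏ i, g i (y i) := by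
    intro y
    by_cases hy : y ∈ Set.univ.pi t
    · rw [Set.indicator_of_mem hy, Finset.prod_eq_single j]
      · simp [hg, hy j (Set.mem_univ j)]
      · intro i _ hi
        simp [hg, hi, hy i (Set.mem_univ i)]
      · simp
    · rw [Set.indicator_of_notMem hy]
      obtain ⟨i, hi⟩ : ∃ i, y i ∉ t i := by simpa [Set.mem_pi] using hy
      exact (Finset.prod_eq_zero (Finset.mem_univ i) (by simp [hg, hi])).symm
  simp_rw [hprod]
  rw [lintegral_prod_eq_prod_lintegral_of_indepFun Finset.univ (fun i (y : ι → ℝ) => g i (y i))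
    (iIndepFun_pi fun i => (hgm i).aemeasurable) fun i => (hgm i).comp (measurable_pi_apply i)]
  refine Finset.prod_congr rfl fun i _ => ?_
  rw [(measurePreserving_eval μ i).lintegral_comp (hgm i), hg]
  simp only
  rw [lintegral_indicator (ht i)]
  by_cases h : i = j
  · subst h
    simp [hν, withDensity_apply _ (ht i)]
  · simp [h]

/-- An event cannot detect more than half a standard deviation of a square-integrable variable. -/
lemma setIntegral_le_integral_mul_add_half_sqrt_variance {Ω : Type*} [MeasurableSpace Ω]
    (P : Measure Ω) [IsProbabilityMeasure P] {f : Ω → ℝ} (hf : MemLp f 2 P)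
    {A : Set Ω} (hA : MeasurableSet A) :
    ∫ ω in A, f ω ∂P ≤ (∫ ω, f ω ∂P) * P.real A + 1 / 2 * Real.sqrt (variance f P) := by
  set c := ∫ ω, f ω ∂P with hc
  have hfi : Integrable f P := hf.integrable (by norm_num)
  have hg : MemLp (fun ω => f ω - c) 2 P := hf.sub (memLp_const c)
  have hgi : Integrable (fun ω => f ω - c) P := hg.integrable (by norm_num)
  have hzero : ∫ ω, (f ω - c) ∂P = 0 := by
    rw [integral_sub hfi (integrable_const c)]; simp [hc]
  have habs : ∫ ω, |f ω - c| ∂P ≤ Real.sqrt (variance f P) := by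
    apply Real.le_sqrt_of_sq_le
    have h := variance_nonneg (fun ω => |f ω - c|) P
    rw [variance_eq_sub (show MemLp (fun ω => |f ω - c|) 2 P from hg.abs)] at h
    rw [variance_eq_integral hf.aemeasurable]
    simpa [sq_abs] using h
  have hhalf : ∫ ω in A, (f ω - c) ∂P ≤ 1 / 2 * ∫ ω, |f ω - c| ∂P := by
    have : (∫ ω, (|f ω - c| + (f ω - c)) / 2 ∂P) = 1 / 2 * ∫ ω, |f ω - c| ∂P := by
      rw [integral_div, integral_add hgi.abs hgi, hzero]; ring
    rw [← this, ← integral_indicator hA]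
    refine integral_mono (hgi.indicator hA) ((hgi.abs.add hgi).div_const 2) fun ω => ?_
    by_cases h : ω ∈ A
    · simp only [Set.indicator_of_mem h]; linarith [le_abs_self (f ω - c)]
    · simp only [Set.indicator_of_notMem h]; linarith [neg_abs_le (f ω - c)]
  rw [integral_sub hfi.integrableOn (integrable_const c).integrableOn, setIntegral_const,
    smul_eq_mul] at hhalf
  linarith [mul_comm c (P.real A)]

instance isProbabilityMeasure_stdNormalMeans (n : ℕ) (β : Fin n → ℝ) :
    IsProbabilityMeasure (stdNormalMeans n β) := by
  unfold stdNormalMeans; infer_instance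

/-- The vector equal to `τ` on `T` and to `0` elsewhere. -/
noncomputable def spike {n : ℕ} (τ : ℝ) (T : Finset (Fin n)) : Fin n → ℝ :=
  fun i => if i ∈ T then τ else 0

lemma spike_mem_sparse {n s : ℕ} (τ : ℝ) {T : Finset (Fin n)} (hT : T.card ≤ s) :
    spike τ T ∈ Sparse n s := by
  have : {i | spike τ T i ≠ 0} ⊆ (T : Set (Fin n)) := by
    intro i hi
    by_contra h
    exact hi (if_neg h)
  exact (Set.ncard_le_ncard this T.finite_toSet).trans (by simpa using hT)

lemma stdNormalMeans_spike_insert {n : ℕ} (τ : ℝ) {T : Finset (Fin n)} {j : Fin n} (hj : j ∉ T) :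
    stdNormalMeans n (spike τ (insert j T)) =
      (stdNormalMeans n (spike τ T)).withDensity
        fun y => ENNReal.ofReal (gaussianLR τ (y j)) := by
  unfold stdNormalMeans
  rw [← pi_update_withDensity (fun i => gaussianReal (spike τ T i) 1) j
    (measurable_gaussianLR τ).ennreal_ofReal (gaussianReal τ 1)]
  · congr 1
    ext i : 1
    by_cases h : i = j
    · subst h; simp [spike]
    · simp [spike, h]
  · simpa [spike, hj] using gaussianReal_eq_withDensity_gaussianLR τ

/-- Second-moment bound for a mixture of single extra spikes. -/
lemma sum_stdNormalMeans_spike_insert_le {n : ℕ} (τ : ℝ) (T : Finset (Fin n))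
    {A : Set (Fin n → ℝ)} (hA : MeasurableSet A) :
    ∑ j ∈ Tᶜ, (stdNormalMeans n (spike τ (insert j T))).real A ≤
      Tᶜ.card * (stdNormalMeans n (spike τ T)).real A +
        1 / 2 * Real.sqrt (Tᶜ.card * (Real.exp (τ ^ 2) - 1)) := by
  set P := stdNormalMeans n (spike τ T) with hP
  have hlaw : ∀ j ∉ T, gaussianReal (spike τ T j) 1 = gaussianReal 0 1 := by
    intro j hj; simp [spike, hj]
  have hmem : ∀ j ∉ T, MemLp (fun y : Fin n → ℝ => gaussianLR τ (y j)) 2 P := by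
    intro j hj
    refine MemLp.comp_measurePreserving (g := gaussianLR τ) (memLp_gaussianLR τ) ?_
    rw [← hlaw j hj]
    exact measurePreserving_eval (fun i => gaussianReal (spike τ T i) 1) j
  have hreal : ∀ j ∈ Tᶜ, (stdNormalMeans n (spike τ (insert j T))).real A =
      ∫ y in A, gaussianLR τ (y j) ∂P := by
    intro j hj
    rw [Finset.mem_compl] at hj
    rw [stdNormalMeans_spike_insert τ hj, Measure.real, withDensity_apply _ hA,
      integral_eq_lintegral_of_nonneg_ae]
    · exact Filter.Eventually.of_forall fun y => (Real.exp_pos _).le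
    · exact ((measurable_gaussianLR τ).comp (measurable_pi_apply j)).aestronglyMeasurable
  have hint : ∫ y, ∑ j ∈ Tᶜ, gaussianLR τ (y j) ∂P = Tᶜ.card := by
    rw [integral_finsetSum _ fun j hj =>
      (hmem j (Finset.mem_compl.1 hj)).integrable (by norm_num)]
    rw [Finset.card_eq_sum_ones, Nat.cast_sum]
    refine Finset.sum_congr rfl fun j hj => ?_
    rw [hP, stdNormalMeans, integral_comp_eval (μ := fun i => gaussianReal (spike τ T i) 1)
      (measurable_gaussianLR τ).aestronglyMeasurable, hlaw j (Finset.mem_compl.1 hj),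
      integral_gaussianLR, Nat.cast_one]
  have hvar : variance (fun y => ∑ j ∈ Tᶜ, gaussianLR τ (y j)) P =
      Tᶜ.card * (Real.exp (τ ^ 2) - 1) := by
    have h := variance_sum_pi (μ := fun i => gaussianReal (spike τ T i) 1)
      (X := fun j => if j ∈ Tᶜ then gaussianLR τ else 0) (fun j => by
        by_cases hj : j ∈ Tᶜ
        · simp only [hj, if_true, hlaw j (Finset.mem_compl.1 hj)]
          exact memLp_gaussianLR τ
        · simp only [hj, if_false]
          exact MemLp.zero)
    have hsum : (∑ j, fun y : Fin n → ℝ => (if j ∈ Tᶜ then gaussianLR τ else 0) (y j)) =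
        fun y => ∑ j ∈ Tᶜ, gaussianLR τ (y j) := by
      ext y
      rw [Finset.sum_apply, ← Finset.sum_filter_add_sum_filter_not _ (· ∈ Tᶜ)]
      rw [Finset.sum_eq_zero (s := Finset.univ.filter (· ∉ Tᶜ))
        fun j hj => by simp [(Finset.mem_filter.1 hj).2], add_zero, Finset.filter_mem_eq_inter,
        Finset.univ_inter]
      exact Finset.sum_congr rfl fun j hj => by rw [if_pos hj]
    rw [hsum] at h
    rw [hP, stdNormalMeans, h, ← nsmul_eq_mul, ← Finset.sum_const]
    rw [← Finset.sum_subset (Finset.subset_univ Tᶜ) fun j _ hj => by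
      simp only [hj, if_false]; exact variance_zero _]
    refine Finset.sum_congr rfl fun j hj => ?_
    rw [if_pos hj, hlaw j (Finset.mem_compl.1 hj), variance_gaussianLR]
  have h := setIntegral_le_integral_mul_add_half_sqrt_variance P
    (memLp_finsetSum Tᶜ fun j hj => hmem j (Finset.mem_compl.1 hj)) hA
  rw [hint, hvar] at h
  rwa [integral_finsetSum _ fun j hj =>
    ((hmem j (Finset.mem_compl.1 hj)).integrable (by norm_num)).integrableOn,
    ← Finset.sum_congr rfl hreal] at h

/-- Double counting of pairs (set of size `k + 1`, element of it). -/
lemma sum_powersetCard_sum_mem {α : Type*} [Fintype α] [DecidableEq α] (k : ℕ)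
    (F : Finset α → α → ℝ) :
    ∑ S ∈ Finset.powersetCard (k + 1) Finset.univ, ∑ j ∈ S, F S j =
      ∑ T ∈ Finset.powersetCard k (Finset.univ : Finset α), ∑ j ∈ Tᶜ, F (insert j T) j := by
  rw [Finset.sum_sigma', Finset.sum_sigma']
  refine Finset.sum_bij' (fun p _ => ⟨p.1.erase p.2, p.2⟩) (fun p _ => ⟨insert p.2 p.1, p.2⟩)
    ?_ ?_ ?_ ?_ ?_
  · rintro ⟨S, j⟩ h
    simp only [Finset.mem_sigma, Finset.mem_powersetCard_univ] at h
    simp [Finset.card_erase_of_mem h.2, h.1]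
  · rintro ⟨T, j⟩ h
    simp only [Finset.mem_sigma, Finset.mem_powersetCard_univ, Finset.mem_compl] at h
    simp [Finset.card_insert_of_notMem h.2, h.1]
  · rintro ⟨S, j⟩ h
    simp only [Finset.mem_sigma] at h
    simp [Finset.insert_erase h.2]
  · rintro ⟨T, j⟩ h
    simp only [Finset.mem_sigma, Finset.mem_compl] at h
    simp [Finset.erase_insert h.2]
  · rintro ⟨S, j⟩ h
    simp only [Finset.mem_sigma] at h
    simp [Finset.insert_erase h.2]

lemma ofReal_sum_miss_le_l2risk {n : ℕ} (τ : ℝ) (S : Finset (Fin n))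
    {bh : (Fin n → ℝ) → Fin n → ℝ} (hmeas : Measurable bh) :
    ENNReal.ofReal (τ ^ 2 * ∑ j ∈ S,
        (1 - (stdNormalMeans n (spike τ S)).real {y | bh y j ≠ 0})) ≤
      l2risk n bh (spike τ S) := by
  set P := stdNormalMeans n (spike τ S)
  have hM : ∀ j, MeasurableSet {y | bh y j ≠ 0} := fun j =>
    ((measurable_pi_apply j).comp hmeas) (measurableSet_singleton (0 : ℝ)).compl
  have hterm : ∀ j, 1 - P.real {y | bh y j ≠ 0} = P.real {y | bh y j ≠ 0}ᶜ := fun j => by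
    rw [probReal_compl_eq_one_sub (hM j)]
  have hpt : ∀ y, ∑ j ∈ S, ENNReal.ofReal (τ ^ 2) * ({y | bh y j ≠ 0}ᶜ).indicator 1 y ≤
      ENNReal.ofReal (∑ i, (bh y i - spike τ S i) ^ 2) := by
    intro y
    rw [ENNReal.ofReal_sum_of_nonneg fun i _ => sq_nonneg _]
    refine le_trans (Finset.sum_le_sum fun j hj => ?_)
      (Finset.sum_le_sum_of_subset (Finset.subset_univ S))
    by_cases h : bh y j = 0
    · simp [h, spike, hj]
    · simp [h]
  refine le_trans (le_of_eq ?_) (lintegral_mono hpt)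
  rw [lintegral_finsetSum _ fun j _ =>
    (measurable_one.indicator (hM j).compl).const_mul _, Finset.mul_sum,
    ENNReal.ofReal_sum_of_nonneg fun j _ => by rw [hterm]; positivity]
  refine Finset.sum_congr rfl fun j _ => ?_
  rw [lintegral_const_mul _ (measurable_one.indicator (hM j).compl),
    lintegral_indicator_one (hM j).compl, hterm, ENNReal.ofReal_mul (sq_nonneg τ),
    ofReal_measureReal]

lemma measurable_FPcount {n : ℕ} (β : Fin n → ℝ) : Measurable fun b => FPcount b β := by
  classical
  have h : (fun b => FPcount b β) = fun b => ∑ i, if b i ≠ 0 ∧ β i = 0 then 1 else 0 := by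
    ext b
    rw [FPcount, Set.ncard_eq_toFinset_card', Set.toFinset_ofPred, Finset.card_filter]
  rw [h]
  refine Finset.measurable_sum _ fun i _ => Measurable.ite ?_ measurable_const measurable_const
  have hi : MeasurableSet {b : Fin n → ℝ | b i ≠ 0} :=
    (measurable_pi_apply (X := fun _ : Fin n => ℝ) i) (measurableSet_singleton (0 : ℝ)).compl
  exact hi.inter (MeasurableSet.const _)

/-- Incompatibility between rate-minimaxity and no false discovery
(Theorem 2 of the paper, quantitative form): for every `c3 ∈ (0,1)`,
any estimator `β̂`, and `2 ≤ s ≤ n`, with `m = (n − s + 1)/2` and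
`δ_n = (1/2)√((n^{c3} − 1)/m)`,
`sup_{β ∈ B(n,s)} E_β‖β̂ − β‖² ≥ (c3/2)·(1 − sup_{β ∈ B(n,s)} P_β(FP(β̂) > 0) − δ_n)·s·log n`. -/
theorem no_false_discovery_rate_penalty (c3 : ℝ) (hc3 : c3 ∈ Set.Ioo (0 : ℝ) 1)
    (n s : ℕ) (h2 : 2 ≤ s) (hsn : s ≤ n)
    (bh : (Fin n → ℝ) → Fin n → ℝ) (hmeas : Measurable bh) :
    ENNReal.ofReal
        ((c3 / 2) *
          (1 -
            (⨆ β ∈ Sparse n s,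
              stdNormalMeans n β {y | 0 < FPcount (bh y) β}).toReal -
            (1 / 2) * Real.sqrt (((n : ℝ) ^ c3 - 1) / (((n : ℝ) - s + 1) / 2)))
          * s * Real.log n) ≤
      ⨆ β ∈ Sparse n s, l2risk n bh β := by
  have hn : (1 : ℝ) < n := by exact_mod_cast (by omega : 1 < n)
  have hlog : 0 < Real.log n := Real.log_pos hn
  obtain ⟨hc0, -⟩ := hc3
  set p := (⨆ β ∈ Sparse n s, stdNormalMeans n β {y | 0 < FPcount (bh y) β}).toReal with hp
  set N : ℝ := (n : ℝ) - s + 1 with hN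
  have hNpos : 0 < N := by
    have : (s : ℝ) ≤ n := by exact_mod_cast hsn
    linarith
  set τ := Real.sqrt (c3 * Real.log n) with hτ
  have hτ2 : τ ^ 2 = c3 * Real.log n := Real.sq_sqrt (by positivity)
  have hτ0 : τ ≠ 0 := (Real.sqrt_pos.2 (by positivity)).ne'
  have hexp : Real.exp (τ ^ 2) = (n : ℝ) ^ c3 := by
    rw [hτ2, Real.rpow_def_of_pos (by linarith), mul_comm]
  set v : ℝ := (n : ℝ) ^ c3 - 1 with hv
  have hv0 : 0 ≤ v := sub_nonneg.2 (Real.one_le_rpow hn.le hc0.le)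
  set δ := 1 / 2 * Real.sqrt (v / (N / 2)) with hδ
  have hfp : ∀ β ∈ Sparse n s, (stdNormalMeans n β).real {y | 0 < FPcount (bh y) β} ≤ p := by
    intro β hβ
    refine ENNReal.toReal_mono (ne_top_of_le_ne_top ENNReal.one_ne_top ?_)
      (le_iSup₂_of_le β hβ le_rfl)
    exact iSup₂_le fun β _ => prob_le_one
  obtain ⟨k, rfl⟩ : ∃ k, s = k + 1 := ⟨s - 1, by omega⟩
  have hT : ∀ T ∈ Finset.powersetCard k (Finset.univ : Finset (Fin n)),
      ∑ j ∈ Tᶜ, (stdNormalMeans n (spike τ (insert j T))).real {y | bh y j ≠ 0} ≤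
        ∑ j ∈ Tᶜ, (p + δ) := by
    intro T hT
    rw [Finset.mem_powersetCard_univ] at hT
    have hcard : ((Tᶜ.card : ℕ) : ℝ) = N := by
      rw [Finset.card_compl, Fintype.card_fin, hT, Nat.cast_sub (by omega), hN]
      push_cast
      ring
    have hA : MeasurableSet {y | 0 < FPcount (bh y) (spike τ T)} :=
      measurableSet_lt measurable_const ((measurable_FPcount _).comp hmeas)
    have hsub : ∀ j ∈ Tᶜ, (stdNormalMeans n (spike τ (insert j T))).real {y | bh y j ≠ 0} ≤
        (stdNormalMeans n (spike τ (insert j T))).real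
          {y | 0 < FPcount (bh y) (spike τ T)} := by
      intro j hj
      refine measureReal_mono fun y hy => ?_
      refine (Set.ncard_pos (Set.toFinite _)).2 ⟨j, hy, ?_⟩
      simpa [spike] using fun h => absurd h (Finset.mem_compl.1 hj)
    refine (Finset.sum_le_sum hsub).trans ((sum_stdNormalMeans_spike_insert_le τ T hA).trans ?_)
    rw [Finset.sum_const, nsmul_eq_mul, hcard, mul_add, hexp]
    have hsqrt : Real.sqrt (N * v) ≤ N * Real.sqrt (v / (N / 2)) := by
      rw [← Real.sqrt_sq hNpos.le, ← Real.sqrt_mul (sq_nonneg N), Real.sqrt_sq hNpos.le]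
      refine Real.sqrt_le_sqrt ?_
      have : N ^ 2 * (v / (N / 2)) = 2 * (N * v) := by field_simp
      rw [this]
      linarith [mul_nonneg hNpos.le hv0]
    have := mul_le_mul_of_nonneg_left (hfp _ (spike_mem_sparse τ (by omega : T.card ≤ k + 1)))
      hNpos.le
    rw [hδ]
    linarith
  have hle := Finset.sum_le_sum hT
  rw [← sum_powersetCard_sum_mem k
      fun S j => (stdNormalMeans n (spike τ S)).real {y | bh y j ≠ 0},
    ← sum_powersetCard_sum_mem k fun _ _ => p + δ] at hle
  obtain ⟨S, hS, hSle⟩ := Finset.exists_le_of_sum_le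
    (Finset.powersetCard_nonempty.2 (by simpa using hsn)) hle
  rw [Finset.mem_powersetCard_univ] at hS
  refine le_trans ?_ (le_iSup₂_of_le (spike τ S) (spike_mem_sparse τ hS.le)
    (ofReal_sum_miss_le_l2risk τ S hmeas))
  rw [Finset.sum_const, hS, nsmul_eq_mul] at hSle
  rw [Finset.sum_sub_distrib, Finset.sum_const, hS, nsmul_eq_mul, mul_one, hτ2]
  by_cases hneg : 1 - p - δ ≤ 0
  · rw [ENNReal.ofReal_of_nonpos]
    · exact zero_le
    · have : 0 ≤ c3 / 2 * ((k + 1 : ℕ) : ℝ) * Real.log n := by positivity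
      nlinarith [mul_nonneg this (neg_nonneg.2 hneg)]
  · push Not at hneg
    refine ENNReal.ofReal_le_ofReal ?_
    have h1 : ((k + 1 : ℕ) : ℝ) * (1 - p - δ) ≤ ((k + 1 : ℕ) : ℝ) -
        ∑ j ∈ S, (stdNormalMeans n (spike τ S)).real {y | bh y j ≠ 0} := by
      linarith
    have h2 := mul_le_mul_of_nonneg_left h1 (by positivity : 0 ≤ c3 * Real.log n)
    refine le_trans ?_ h2
    have : 0 ≤ c3 * Real.log n * (((k + 1 : ℕ) : ℝ) * (1 - p - δ)) := by positivity
    linarith
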